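/- arXiv:1708.06019 — 3 statements merged into one kernel-verified Lean document; each statement's English description precedes it below -/
import Mathlib

section
/- For every fixed positive integer k and all n with 2 ≤ n, the normalized function T(n,k)/2^n is non-increasing in n; i.e., T(n+1,k)/2^{n+1} ≤ T(n,k)/2^n, so the characteristic capacity curve is monotonically decreasing past the shattering point. -/
/-- Cover's threshold-function counting function:
`T n k = 2 * ∑_{l=0}^{k-1} C(n-1, l)`. -/
def coverT (n k : ℕ) : ℕ := 2 * ∑ l ∈ Finset.range k, (n - 1).choose l

/-- Partial row sums of Pascal's triangle at most double from one row to the next. -/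
theorem sum_range_choose_succ_le_two_mul (m k : ℕ) :
    ∑ l ∈ Finset.range k, (m + 1).choose l ≤ 2 * ∑ l ∈ Finset.range k, m.choose l := by
  cases k with
  | zero => simp
  | succ j =>
    have hsum : ∑ l ∈ Finset.range (j + 1), (m + 1).choose l =
        ∑ l ∈ Finset.range j, m.choose l + ∑ l ∈ Finset.range (j + 1), m.choose l := by
      simp only [Finset.sum_range_succ' _ j, Nat.choose_succ_succ, Finset.sum_add_distrib,
        Nat.choose_zero_right, Nat.succ_eq_add_one, add_assoc]
    rw [hsum, Finset.sum_range_succ _ j]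
    omega

/-- Adding a point at most doubles the counting function. -/
theorem coverT_succ_le_two_mul (n k : ℕ) (hn : 0 < n) : coverT (n + 1) k ≤ 2 * coverT n k := by
  obtain ⟨m, rfl⟩ := Nat.exists_eq_succ_of_ne_zero hn.ne'
  exact Nat.mul_le_mul_left 2 (sum_range_choose_succ_le_two_mul m k)

/-- For every fixed positive integer `k` and all `n ≥ 2`, the normalized function
`T(n,k)/2^n` is non-increasing in `n`: `T(n+1,k)/2^{n+1} ≤ T(n,k)/2^n`, so the
characteristic capacity curve is monotonically decreasing past the shattering
point. -/
theorem coverT_ratio_antitone (k : ℕ) (hk : 0 < k) :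
    ∀ n : ℕ, 2 ≤ n →
      (coverT (n + 1) k : ℝ) / 2 ^ (n + 1) ≤ (coverT n k : ℝ) / 2 ^ n := by
  intro n hn
  have h : (coverT (n + 1) k : ℝ) ≤ 2 * coverT n k :=
    mod_cast coverT_succ_le_two_mul n k (by omega)
  rw [div_le_div_iff₀ (by positivity) (by positivity), pow_succ]
  calc (coverT (n + 1) k : ℝ) * 2 ^ n ≤ 2 * coverT n k * 2 ^ n := by gcongr
    _ = coverT n k * (2 ^ n * 2) := by ring
end

section
/- (Upper capacity of a perceptron.) For every positive integer k and every set of k+2 points in ℝ^k, there exists a binary labeling of these points that cannot be realized by any affine threshold function x ↦ (⟨w, x⟩ > b) with w ∈ ℝ^k, b ∈ ℝ; i.e., no set of k+2 points in ℝ^k is shattered by affine halfspaces. -/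
/-- (Upper capacity of a perceptron.) For every positive integer `k` and every
set of `k+2` points in `ℝ^k`, there exists a binary labeling of these points
that cannot be realized by any affine threshold function `x ↦ (⟨w, x⟩ > b)`
with `w ∈ ℝ^k`, `b ∈ ℝ`: no set of `k+2` points in `ℝ^k` is shattered by
affine halfspaces. -/
theorem perceptron_cannot_shatter_k_add_two_points (k : ℕ) (hk : 0 < k)
    (pts : Fin (k + 2) → (Fin k → ℝ)) :
    ∃ labeling : Fin (k + 2) → Bool, ∀ (w : Fin k → ℝ) (b : ℝ),
      ¬ ∀ i : Fin (k + 2), ((∑ j, w j * pts i j) > b ↔ labeling i = true) := by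
  have hdep : ¬ AffineIndependent ℝ pts := by
    intro h
    have hcard := h.card_le_finrank_succ
    have hle := Submodule.finrank_le (vectorSpan ℝ (Set.range pts))
    rw [Module.finrank_fin_fun] at hle
    rw [Fintype.card_fin] at hcard
    omega
  obtain ⟨I, p, hpI, hpJ⟩ := Convex.radon_partition hdep
  classical
  refine ⟨fun i => decide (i ∈ I), fun w b h => ?_⟩
  have hlin : IsLinearMap ℝ (fun x : Fin k → ℝ => ∑ j, w j * x j) :=
    (dotProductBilin ℝ ℝ w).isLinear
  have hgt : convexHull ℝ (pts '' I) ⊆ {x | b < ∑ j, w j * x j} := by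
    refine convexHull_min ?_ (convex_halfSpace_gt hlin b)
    rintro _ ⟨i, hi, rfl⟩
    exact (h i).2 (by simpa using hi)
  have hle : convexHull ℝ (pts '' Iᶜ) ⊆ {x | ∑ j, w j * x j ≤ b} := by
    refine convexHull_min ?_ (convex_halfSpace_le hlin b)
    rintro _ ⟨i, hi, rfl⟩
    exact not_lt.1 fun hb => hi (by simpa using (h i).1 hb)
  have hbp : b < ∑ j, w j * p j := hgt hpI
  have hpb : ∑ j, w j * p j ≤ b := hle hpJ
  exact hbp.not_ge hpb
end

section
/- (Full shattering below capacity.) Let x₁, …, xₙ be n points in ℝ^k in general position with n ≤ k. Then for every binary labeling of the n points there exists w ∈ ℝ^k such that the homogeneous threshold function xᵢ ↦ (⟨w, xᵢ⟩ > 0) realizes that labeling; i.e., all 2^n dichotomies are realizable, matching T(n,k) = 2^n for k ≥ n. -/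
/-- A linearly independent family admits a linear functional with prescribed values on it. -/
theorem LinearIndependent.exists_dual_apply_eq {ι K V : Type*} [Field K] [AddCommGroup V]
    [Module K V] {v : ι → V} (hv : LinearIndependent K v) (c : ι → K) :
    ∃ f : V →ₗ[K] K, ∀ i, f (v i) = c i := by
  obtain ⟨g, hg⟩ := (Finsupp.linearCombination K v).exists_leftInverse_of_injective
    (LinearMap.ker_eq_bot.mpr hv)
  refine ⟨Finsupp.linearCombination K c ∘ₗ g, fun i => ?_⟩
  have hgi : g (v i) = Finsupp.single i 1 := by
    simpa using LinearMap.congr_fun hg (Finsupp.single i 1)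
  simp [hgi]


/-- (Full shattering below capacity.) Let `x₁, …, xₙ` be `n` points in `ℝ^k` in
general position with `n ≤ k`. Then for every binary labeling of the `n` points
there exists `w ∈ ℝ^k` such that the homogeneous threshold function
`i ↦ (⟨w, xᵢ⟩ > 0)` realizes that labeling: all `2^n` dichotomies are
realizable, matching `T(n,k) = 2^n` for `k ≥ n`. -/
theorem full_shattering_below_capacity (n k : ℕ) (hn : 0 < n) (hk : 0 < k)
    (hnk : n ≤ k) (pts : Fin n → (Fin k → ℝ))
    (hgen : ∀ s : Finset (Fin n), s.card ≤ k →
      LinearIndependent ℝ (fun i : s => pts i)) :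
    ∀ labeling : Fin n → Bool, ∃ w : Fin k → ℝ,
      ∀ i, (labeling i = true ↔ (∑ j, w j * pts i j) > 0) := by
  intro labeling
  have hli : LinearIndependent ℝ pts := by
    have h := hgen Finset.univ (by simpa using hnk)
    exact h.comp (fun i => ⟨i, Finset.mem_univ i⟩) fun i j hij => congrArg Subtype.val hij
  obtain ⟨f, hf⟩ := hli.exists_dual_apply_eq fun i => if labeling i = true then 1 else 0
  refine ⟨fun j => f (Pi.single j 1), fun i => ?_⟩
  have hsum : ∑ j, f (Pi.single j 1) * pts i j = f (pts i) := by
    rw [f.pi_apply_eq_sum_univ (pts i)]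
    refine Finset.sum_congr rfl fun j _ => ?_
    rw [smul_eq_mul, mul_comm]
    congr 2
    ext l
    simp [Pi.single_apply, eq_comm]
  rw [hsum, hf]
  split_ifs with h <;> simp [h]
end
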